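/- For the global solutions (g,k,f) of the Bianchi I Einstein–Boltzmann system given by the main theorem (small data, H(t₀) = 2/(3t₀) > 0, scattering kernel assumption), there exist a small constant ε > 0 and constants C, c > 0 such that the matter terms satisfy, for all t ≥ t₀: c t⁻² ≤ ρ(t) ≤ C t^{−2+ε}, S(t) ≤ C t^{−10/3+ε}, and S(t)/ρ(t) ≤ C t^{−4/3+ε}. -/

import Mathlib

open Matrix MeasureTheory

/-- The Cholesky factor of a symmetric positive definite `3×3` matrix `g`: the lower
triangular matrix `θ` with positive diagonal such that `g = θ * θᵀ`, given by its
explicit formula.  Orthonormal-frame components satisfy `p_* = chol g *ᵥ p̂`. -/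
noncomputable def chol (g : Matrix (Fin 3) (Fin 3) ℝ) : Matrix (Fin 3) (Fin 3) ℝ :=
  !![g 0 0 / Real.sqrt (g 0 0), 0, 0;
     g 0 1 / Real.sqrt (g 0 0),
       (g 0 0 * g 1 1 - g 0 1 ^ 2) /
         (Real.sqrt (g 0 0) * Real.sqrt (g 0 0 * g 1 1 - g 0 1 ^ 2)), 0;
     g 0 2 / Real.sqrt (g 0 0),
       (g 0 0 * g 1 2 - g 0 1 * g 0 2) /
         (Real.sqrt (g 0 0) * Real.sqrt (g 0 0 * g 1 1 - g 0 1 ^ 2)),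
       g.det / (Real.sqrt (g 0 0 * g 1 1 - g 0 1 ^ 2) * Real.sqrt g.det)]

/-- Energy density `ρ = (det g)^{−1/2} ∫ f (1+g^{cd}p_cp_d)^{1/2} dp_*`. -/
noncomputable def rhoC (g : ℝ → Matrix (Fin 3) (Fin 3) ℝ)
    (f : ℝ → (Fin 3 → ℝ) → ℝ) (t : ℝ) : ℝ :=
  (Real.sqrt (g t).det)⁻¹ *
    ∫ p : Fin 3 → ℝ, f t p * Real.sqrt (1 + p ⬝ᵥ ((g t)⁻¹ *ᵥ p))

/-- Stress `S_{ab} = (det g)^{−1/2} ∫ f p_a p_b (1+g^{cd}p_cp_d)^{−1/2} dp_*`. -/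
noncomputable def SmatC (g : ℝ → Matrix (Fin 3) (Fin 3) ℝ)
    (f : ℝ → (Fin 3 → ℝ) → ℝ) (t : ℝ) : Matrix (Fin 3) (Fin 3) ℝ :=
  Matrix.of fun a b =>
    (Real.sqrt (g t).det)⁻¹ *
      ∫ p : Fin 3 → ℝ, f t p * p a * p b / Real.sqrt (1 + p ⬝ᵥ ((g t)⁻¹ *ᵥ p))

/-- The trace `S = g^{ab} S_{ab}`. -/
noncomputable def StrC (g : ℝ → Matrix (Fin 3) (Fin 3) ℝ)
    (f : ℝ → (Fin 3 → ℝ) → ℝ) (t : ℝ) : ℝ :=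
  Matrix.trace ((g t)⁻¹ * SmatC g f t)

/-- The particle current density `N⁰ = (det g)^{−1/2} ∫ f dp_*`. -/
noncomputable def Ncur (g : ℝ → Matrix (Fin 3) (Fin 3) ℝ)
    (f : ℝ → (Fin 3 → ℝ) → ℝ) (t : ℝ) : ℝ :=
  (Real.sqrt (g t).det)⁻¹ * ∫ p : Fin 3 → ℝ, f t p

theorem Matrix.PosDef.leading_minor_two_pos {g : Matrix (Fin 3) (Fin 3) ℝ} (hg : g.PosDef) :
    0 < g 0 0 * g 1 1 - g 0 1 ^ 2 := by
  have h := (hg.submatrix (e := Fin.castSucc (n := 2)) (Fin.castSucc_injective 2)).det_pos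
  have hs : g 1 0 = g 0 1 := by simpa using hg.isHermitian.apply 0 1
  simp only [Matrix.det_fin_two, Matrix.submatrix_apply] at h
  change 0 < g 0 0 * g 1 1 - g 0 1 * g 1 0 at h
  rw [hs] at h
  linarith [pow_two (g 0 1)]

theorem chol_mul_transpose {g : Matrix (Fin 3) (Fin 3) ℝ} (hg : g.PosDef) :
    chol g * (chol g)ᵀ = g := by
  have h00 : 0 < g 0 0 := hg.diag_pos
  have hm := hg.leading_minor_two_pos
  have hd := hg.det_pos
  have h10 : g 1 0 = g 0 1 := by simpa using hg.isHermitian.apply 0 1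
  have h20 : g 2 0 = g 0 2 := by simpa using hg.isHermitian.apply 0 2
  have h21 : g 2 1 = g 1 2 := by simpa using hg.isHermitian.apply 1 2
  have hdet : g.det = g 0 0 * g 1 1 * g 2 2 - g 0 0 * g 1 2 ^ 2 - g 0 1 ^ 2 * g 2 2
      + 2 * g 0 1 * g 1 2 * g 0 2 - g 0 2 ^ 2 * g 1 1 := by
    rw [Matrix.det_fin_three, h10, h20, h21]; ring
  have ha := Real.sq_sqrt h00.le
  have hb := Real.sq_sqrt hm.le
  have hc := Real.sq_sqrt hd.le
  have ha0 := Real.sqrt_pos.2 h00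
  have hb0 := Real.sqrt_pos.2 hm
  have hc0 := Real.sqrt_pos.2 hd
  unfold chol
  set a := Real.sqrt (g 0 0)
  set b := Real.sqrt (g 0 0 * g 1 1 - g 0 1 ^ 2)
  set c := Real.sqrt g.det
  set d := g.det
  have e22 : g 0 2 / a * (g 0 2 / a) + (g 0 0 * g 1 2 - g 0 1 * g 0 2) / (a * b) *
      ((g 0 0 * g 1 2 - g 0 1 * g 0 2) / (a * b)) + d / (b * c) * (d / (b * c)) = g 2 2 := by
    have : g 0 2 / a * (g 0 2 / a) + (g 0 0 * g 1 2 - g 0 1 * g 0 2) / (a * b) *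
      ((g 0 0 * g 1 2 - g 0 1 * g 0 2) / (a * b)) + d / (b * c) * (d / (b * c)) =
      g 0 2 ^ 2 / a ^ 2 + (g 0 0 * g 1 2 - g 0 1 * g 0 2) ^ 2 / (a ^ 2 * b ^ 2)
        + d ^ 2 / (b ^ 2 * c ^ 2) := by ring
    rw [this, ha, hb, hc]
    have hm' := hm.ne'
    field_simp
    rw [hdet]
    ring
  have e11 : g 0 1 / a * (g 0 1 / a) + (g 0 0 * g 1 1 - g 0 1 ^ 2) / (a * b) *
      ((g 0 0 * g 1 1 - g 0 1 ^ 2) / (a * b)) = g 1 1 := by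
    rw [← hb]; field_simp; rw [hb, ha]; ring
  have e12 : g 0 1 / a * (g 0 2 / a) + (g 0 0 * g 1 1 - g 0 1 ^ 2) / (a * b) *
      ((g 0 0 * g 1 2 - g 0 1 * g 0 2) / (a * b)) = g 1 2 := by
    rw [← hb]; field_simp; rw [ha]; ring
  have e0 (x : ℝ) : g 0 0 / a * (x / a) = x := by
    rw [← ha]; field_simp
  ext i j
  fin_cases i <;> fin_cases j <;>
    simp [Matrix.mul_apply, Fin.sum_univ_three, h10, h20, h21, e0, e11, e12, e22]
  all_goals first
    | (rw [mul_comm]; exact e0 _)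
    | (linarith [e12])

theorem chol_det_mul_self {g : Matrix (Fin 3) (Fin 3) ℝ} (hg : g.PosDef) :
    (chol g).det * (chol g).det = g.det := by
  conv_rhs => rw [← chol_mul_transpose hg]
  rw [Matrix.det_mul, Matrix.det_transpose]

theorem abs_det_chol {g : Matrix (Fin 3) (Fin 3) ℝ} (hg : g.PosDef) :
    |(chol g).det| = Real.sqrt g.det := by
  rw [← chol_det_mul_self hg, Real.sqrt_mul_self_eq_abs]

theorem isUnit_det_chol {g : Matrix (Fin 3) (Fin 3) ℝ} (hg : g.PosDef) :
    IsUnit (chol g).det := by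
  rw [isUnit_iff_ne_zero]
  intro h
  have := chol_det_mul_self hg
  rw [h] at this
  linarith [hg.det_pos]

theorem dotProduct_inv_mulVec_eq {g : Matrix (Fin 3) (Fin 3) ℝ} (hg : g.PosDef)
    (p : Fin 3 → ℝ) :
    p ⬝ᵥ (g⁻¹ *ᵥ p) = ((chol g)⁻¹ *ᵥ p) ⬝ᵥ ((chol g)⁻¹ *ᵥ p) := by
  conv_lhs => rw [← chol_mul_transpose hg]
  rw [Matrix.mul_inv_rev, ← Matrix.mulVec_mulVec, Matrix.dotProduct_mulVec,
    ← Matrix.transpose_nonsing_inv, Matrix.vecMul_transpose]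

theorem dotProduct_inv_mulVec_nonneg {g : Matrix (Fin 3) (Fin 3) ℝ} (hg : g.PosDef)
    (p : Fin 3 → ℝ) : 0 ≤ p ⬝ᵥ (g⁻¹ *ᵥ p) := by
  rw [dotProduct_inv_mulVec_eq hg]
  simpa using dotProduct_self_star_nonneg ((chol g)⁻¹ *ᵥ p)

/-- A linear change of variables in an integral over `ℝ³`. -/
theorem integrable_comp_mulVec_and_integral {M : Matrix (Fin 3) (Fin 3) ℝ} (hM : IsUnit M.det)
    {F : (Fin 3 → ℝ) → ℝ} (hF : Integrable F) :
    Integrable (fun p => F (M *ᵥ p)) ∧ ∫ p, F (M *ᵥ p) = |M.det|⁻¹ * ∫ x, F x := by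
  have hM0 : M.det ≠ 0 := hM.ne_zero
  have hemb : MeasurableEmbedding (Matrix.toLin' M) := by
    have : IsUnit M := (Matrix.isUnit_iff_isUnit_det M).2 hM
    have hinj : Function.Injective (Matrix.toLin' M) := Matrix.mulVec_injective_of_isUnit this
    exact ((LinearMap.continuous_of_finiteDimensional _).measurableEmbedding hinj)
  have hmap := Real.map_matrix_volume_pi_eq_smul_volume_pi hM0
  constructor
  · have : Integrable F (Measure.map (Matrix.toLin' M) volume) := by
      rw [hmap]; exact hF.smul_measure ENNReal.ofReal_ne_top
    simpa [Function.comp_def] using hemb.integrable_map_iff.1 this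
  · have h := hemb.integral_map (μ := volume) F
    rw [hmap, integral_smul_measure, ENNReal.toReal_ofReal (abs_nonneg _)] at h
    simp only [Matrix.toLin'_apply, smul_eq_mul, abs_inv] at h
    exact h.symm

theorem integrable_exp_neg_dotProduct_self :
    Integrable (fun x : Fin 3 → ℝ => Real.exp (-(x ⬝ᵥ x) / 2)) := by
  have h := Integrable.fintype_prod (ι := Fin 3) (μ := fun _ => (volume : Measure ℝ))
    (f := fun _ (v : ℝ) => Real.exp (-(1 / 2) * v ^ 2))
    (fun _ => integrable_exp_neg_mul_sq (by norm_num))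
  refine h.congr (Filter.Eventually.of_forall fun x => ?_)
  simp only [dotProduct, Fin.sum_univ_three, Fin.prod_univ_three, ← Real.exp_add]
  ring_nf

/-- The Gaussian integral in the orthonormal frame. -/
theorem integrable_gaussian_and_integral {g : Matrix (Fin 3) (Fin 3) ℝ} (hg : g.PosDef)
    {s : ℝ} (hs : 0 < s) :
    Integrable (fun p : Fin 3 → ℝ => Real.exp (-(s * (p ⬝ᵥ (g⁻¹ *ᵥ p))) / 2)) ∧
    (Real.sqrt g.det)⁻¹ * ∫ p : Fin 3 → ℝ, Real.exp (-(s * (p ⬝ᵥ (g⁻¹ *ᵥ p))) / 2) =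
      s ^ (-(3 : ℝ) / 2) * ∫ x : Fin 3 → ℝ, Real.exp (-(x ⬝ᵥ x) / 2) := by
  have hr : 0 < Real.sqrt s := Real.sqrt_pos.2 hs
  have hdet : ((Real.sqrt s) • (chol g)⁻¹).det = Real.sqrt s ^ 3 * (chol g).det⁻¹ := by
    rw [Matrix.det_smul, Matrix.det_nonsing_inv, Ring.inverse_eq_inv']; simp
  have hu : IsUnit ((Real.sqrt s) • (chol g)⁻¹).det := by
    rw [hdet, isUnit_iff_ne_zero]
    exact mul_ne_zero (pow_pos hr 3).ne' (inv_ne_zero (isUnit_det_chol hg).ne_zero)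
  have key (p : Fin 3 → ℝ) : (((Real.sqrt s) • (chol g)⁻¹) *ᵥ p) ⬝ᵥ
      (((Real.sqrt s) • (chol g)⁻¹) *ᵥ p) = s * (p ⬝ᵥ (g⁻¹ *ᵥ p)) := by
    rw [Matrix.smul_mulVec, smul_dotProduct, dotProduct_smul, dotProduct_inv_mulVec_eq hg,
      smul_smul, Real.mul_self_sqrt hs.le, smul_eq_mul]
  have h := integrable_comp_mulVec_and_integral hu integrable_exp_neg_dotProduct_self
  simp only [key] at h
  refine ⟨h.1, ?_⟩
  have hd : 0 < Real.sqrt g.det := Real.sqrt_pos.2 hg.det_pos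
  have hp : Real.sqrt s ^ 3 = s ^ ((3 : ℝ) / 2) := by
    rw [Real.sqrt_eq_rpow, ← Real.rpow_natCast, ← Real.rpow_mul hs.le]; norm_num
  rw [h.2, hdet, abs_mul, abs_inv, abs_det_chol hg, hp, neg_div, Real.rpow_neg hs.le,
    abs_of_pos (Real.rpow_pos_of_pos hs _)]
  field_simp

theorem one_add_mul_exp_neg_le (u : ℝ) :
    (1 + u) * Real.exp (-u) ≤ 2 * Real.exp (-u / 2) := by
  have h : Real.exp (-u) = Real.exp (-u / 2) * Real.exp (-u / 2) := by
    rw [← Real.exp_add]; ring_nf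
  have h1 : 1 + u / 2 ≤ Real.exp (u / 2) := by linarith [Real.add_one_le_exp (u / 2)]
  have h2 : Real.exp (u / 2) * Real.exp (-u / 2) = 1 := by
    rw [← Real.exp_add, ← Real.exp_zero]; ring_nf
  have h3 := Real.exp_pos (-u / 2)
  rw [h]
  have : (1 + u) * Real.exp (-u / 2) ≤ 2 := by nlinarith
  nlinarith

/-- Comparison of an integral over momentum space with the Gaussian integral. -/
theorem momentum_integral_le {g : Matrix (Fin 3) (Fin 3) ℝ} (hg : g.PosDef)
    {s K : ℝ} (hs : 0 < s) {F : (Fin 3 → ℝ) → ℝ} (hF0 : ∀ p, 0 ≤ F p)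
    (hF : ∀ p, F p ≤ K * Real.exp (-(s * (p ⬝ᵥ (g⁻¹ *ᵥ p))) / 2)) :
    (Real.sqrt g.det)⁻¹ * ∫ p, F p ≤
      K * (∫ x : Fin 3 → ℝ, Real.exp (-(x ⬝ᵥ x) / 2)) * s ^ (-(3 : ℝ) / 2) := by
  obtain ⟨h1, h2⟩ := integrable_gaussian_and_integral hg hs
  have h3 := integral_mono_of_nonneg (μ := volume) (Filter.Eventually.of_forall hF0)
    (h1.const_mul K) (Filter.Eventually.of_forall hF)
  rw [integral_const_mul] at h3
  calc _ ≤ (Real.sqrt g.det)⁻¹ * (K * ∫ p : Fin 3 → ℝ,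
        Real.exp (-(s * (p ⬝ᵥ (g⁻¹ *ᵥ p))) / 2)) := by gcongr
    _ = K * ((Real.sqrt g.det)⁻¹ * ∫ p : Fin 3 → ℝ,
        Real.exp (-(s * (p ⬝ᵥ (g⁻¹ *ᵥ p))) / 2)) := by ring
    _ = _ := by rw [h2]; ring

theorem exists_dotProduct_self_le {g : Matrix (Fin 3) (Fin 3) ℝ} (hg : g.PosDef) :
    ∃ K, ∀ p : Fin 3 → ℝ, ∀ a, p a ^ 2 ≤ K * (p ⬝ᵥ (g⁻¹ *ᵥ p)) := by
  refine ⟨∑ a, ∑ b, chol g a b ^ 2, fun p a => ?_⟩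
  have hp : p = chol g *ᵥ ((chol g)⁻¹ *ᵥ p) := by
    rw [Matrix.mulVec_mulVec, Matrix.mul_nonsing_inv _ (isUnit_det_chol hg), Matrix.one_mulVec]
  rw [dotProduct_inv_mulVec_eq hg]
  set x := (chol g)⁻¹ *ᵥ p
  have hx : x ⬝ᵥ x = ∑ b, x b ^ 2 := by simp [dotProduct, pow_two]
  rw [hp, hx]
  calc (chol g *ᵥ x) a ^ 2 = (∑ b, chol g a b * x b) ^ 2 := rfl
    _ ≤ (∑ b, chol g a b ^ 2) * ∑ b, x b ^ 2 := Finset.sum_mul_sq_le_sq_mul_sq _ _ _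
    _ ≤ _ := by
      refine mul_le_mul_of_nonneg_right ?_ (Finset.sum_nonneg fun b _ => sq_nonneg _)
      exact Finset.single_le_sum (f := fun a => ∑ b, chol g a b ^ 2)
        (fun i _ => Finset.sum_nonneg fun b _ => sq_nonneg _) (Finset.mem_univ a)

/-- The trace of the stress as a single momentum integral. -/
theorem StrC_eq {g : ℝ → Matrix (Fin 3) (Fin 3) ℝ} {f : ℝ → (Fin 3 → ℝ) → ℝ} {t : ℝ}
    (hg : (g t).PosDef) (hf : Integrable (f t))
    (hf1 : Integrable (fun p : Fin 3 → ℝ => f t p * Real.sqrt (1 + p ⬝ᵥ ((g t)⁻¹ *ᵥ p)))) :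
    StrC g f t = (Real.sqrt (g t).det)⁻¹ * ∫ p : Fin 3 → ℝ,
      f t p * (p ⬝ᵥ ((g t)⁻¹ *ᵥ p)) / Real.sqrt (1 + p ⬝ᵥ ((g t)⁻¹ *ᵥ p)) := by
  obtain ⟨K, hK⟩ := exists_dotProduct_self_le hg
  have hint (a b : Fin 3) : Integrable (fun p : Fin 3 → ℝ =>
      f t p * p a * p b / Real.sqrt (1 + p ⬝ᵥ ((g t)⁻¹ *ᵥ p))) := by
    have hcont : Continuous fun p : Fin 3 → ℝ => p ⬝ᵥ ((g t)⁻¹ *ᵥ p) := by fun_prop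
    refine (hf1.norm.const_mul |K|).mono' ?_ (Filter.Eventually.of_forall fun p => ?_)
    · have h1 : AEStronglyMeasurable (fun p : Fin 3 → ℝ =>
          p a * p b / Real.sqrt (1 + p ⬝ᵥ ((g t)⁻¹ *ᵥ p))) volume := by
        apply Measurable.aestronglyMeasurable
        have := hcont.measurable
        fun_prop
      refine (hf.aestronglyMeasurable.mul h1).congr (Filter.Eventually.of_forall fun p => ?_)
      simp only [Pi.mul_apply]
      ring
    · have hq := dotProduct_inv_mulVec_nonneg hg p
      have ha := hK p a
      have hb := hK p b
      set q := p ⬝ᵥ ((g t)⁻¹ *ᵥ p)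
      have hr : 0 < Real.sqrt (1 + q) := Real.sqrt_pos.2 (by linarith)
      have hr2 := Real.sq_sqrt (show 0 ≤ 1 + q by linarith)
      have hab : |p a * p b| ≤ |K| * (Real.sqrt (1 + q) * Real.sqrt (1 + q)) := by
        have h1 : |p a * p b| ≤ K * q :=
          abs_le.2 ⟨by nlinarith [sq_nonneg (p a + p b)], by nlinarith [sq_nonneg (p a - p b)]⟩
        have h2 : K * q ≤ |K| * q := by gcongr; exact le_abs_self K
        nlinarith [abs_nonneg K]
      rw [Real.norm_eq_abs, Real.norm_eq_abs, abs_div, abs_of_pos hr, div_le_iff₀ hr,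
        mul_assoc (f t p), abs_mul, abs_mul (f t p) (Real.sqrt _),
        abs_of_pos hr]
      calc |f t p| * |p a * p b| ≤ |f t p| * (|K| * (Real.sqrt (1 + q) * Real.sqrt (1 + q))) := by
            gcongr
        _ = _ := by ring
  have hsum : (fun p : Fin 3 → ℝ =>
      f t p * (p ⬝ᵥ ((g t)⁻¹ *ᵥ p)) / Real.sqrt (1 + p ⬝ᵥ ((g t)⁻¹ *ᵥ p))) =
      fun p => ∑ a, ∑ b, (g t)⁻¹ a b *
        (f t p * p b * p a / Real.sqrt (1 + p ⬝ᵥ ((g t)⁻¹ *ᵥ p))) := by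
    funext p
    set r := Real.sqrt (1 + p ⬝ᵥ ((g t)⁻¹ *ᵥ p))
    simp only [dotProduct, Matrix.mulVec, Fin.sum_univ_three]
    ring
  have hswap (c : Fin 3 → Fin 3 → ℝ) : ∫ p : Fin 3 → ℝ, ∑ a, ∑ b, c a b *
      (f t p * p b * p a / Real.sqrt (1 + p ⬝ᵥ ((g t)⁻¹ *ᵥ p))) = ∑ a, ∑ b, c a b *
      ∫ p : Fin 3 → ℝ, f t p * p b * p a / Real.sqrt (1 + p ⬝ᵥ ((g t)⁻¹ *ᵥ p)) := by
    rw [integral_finsetSum _ fun a _ => integrable_finsetSum _ fun b _ =>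
      (hint b a).const_mul _]
    refine Finset.sum_congr rfl fun a _ => ?_
    rw [integral_finsetSum _ fun b _ => (hint b a).const_mul _]
    exact Finset.sum_congr rfl fun b _ => integral_const_mul _ _
  rw [hsum]
  refine Eq.trans ?_ (congrArg _ (hswap fun a b => (g t)⁻¹ a b).symm)
  simp only [StrC, SmatC, Matrix.trace, Matrix.diag, Matrix.mul_apply, Matrix.of_apply,
    Finset.mul_sum]
  exact Finset.sum_congr rfl fun a _ => Finset.sum_congr rfl fun b _ => mul_left_comm _ _ _

theorem Ncur_le_rhoC {g : ℝ → Matrix (Fin 3) (Fin 3) ℝ} {f : ℝ → (Fin 3 → ℝ) → ℝ} {t : ℝ}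
    (hg : (g t).PosDef) (hf0 : ∀ p, 0 ≤ f t p) (hf : Integrable (f t))
    (hf1 : Integrable (fun p : Fin 3 → ℝ => f t p * Real.sqrt (1 + p ⬝ᵥ ((g t)⁻¹ *ᵥ p)))) :
    Ncur g f t ≤ rhoC g f t := by
  unfold Ncur rhoC
  refine mul_le_mul_of_nonneg_left (integral_mono hf hf1 fun p => ?_) (by positivity)
  have h1 : 1 ≤ Real.sqrt (1 + p ⬝ᵥ ((g t)⁻¹ *ᵥ p)) :=
    Real.one_le_sqrt.2 (by linarith [dotProduct_inv_mulVec_nonneg hg p])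
  exact le_mul_of_one_le_right (hf0 p) h1

/-- If `N' = -3HN` with `N ≥ 0` and `H ≤ 2/(3t)`, then `t²N` does not decrease. -/
theorem sq_mul_le_sq_mul_of_hasDerivWithinAt {t₀ : ℝ} (ht₀ : 0 < t₀) {N H : ℝ → ℝ}
    (hN : ∀ t ∈ Set.Ici t₀, 0 ≤ N t) (hH : ∀ t ∈ Set.Ici t₀, H t ≤ 2 / 3 * t⁻¹)
    (hder : ∀ t ∈ Set.Ici t₀, HasDerivWithinAt N (-3 * H t * N t) (Set.Ici t₀) t)
    {t : ℝ} (ht : t ∈ Set.Ici t₀) : t₀ ^ 2 * N t₀ ≤ t ^ 2 * N t := by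
  have hd (x : ℝ) (hx : x ∈ Set.Ici t₀) := ((hasDerivAt_pow 2 x).hasDerivWithinAt
    (s := Set.Ici t₀)).mul (hder x hx)
  have hmono : MonotoneOn (fun x => x ^ 2 * N x) (Set.Ici t₀) := by
    refine monotoneOn_of_hasDerivWithinAt_nonneg (convex_Ici t₀)
      (fun x hx => (hd x hx).continuousWithinAt)
      (fun x hx => (hd x (interior_subset hx)).mono interior_subset) fun x hx => ?_
    have hx := interior_subset hx
    have hx0 : 0 < x := ht₀.trans_le hx
    have h1 : x * H x ≤ 2 / 3 := by
      calc x * H x ≤ x * (2 / 3 * x⁻¹) := by gcongr; exact hH x hx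
        _ = 2 / 3 := by field_simp
    have h2 : 0 ≤ x * N x * (2 - 3 * (x * H x)) :=
      mul_nonneg (mul_nonneg hx0.le (hN x hx)) (by linarith)
    norm_num
    linarith
  exact hmono Set.self_mem_Ici ht ht

/-- For the global solutions of the Bianchi I Einstein–Boltzmann system given by the
main theorem (in particular, with the Gaussian decay `f̂(t,p̂) ≤ C₀ e^{−t^{4/3−ε₁}|p̂|²}`
in the orthonormal frame, `0 < H(t) ≤ (2/3)t⁻¹`, and `Ṅ⁰ = −3HN⁰` with `N⁰(t₀) > 0`),
the matter terms satisfy `c t⁻² ≤ ρ ≤ C t^{−2+ε}`, `S ≤ C t^{−10/3+ε}` and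
`S/ρ ≤ C t^{−4/3+ε}` at late times. -/
theorem stmt_17 (t₀ : ℝ) (ht₀ : 0 < t₀)
    (g : ℝ → Matrix (Fin 3) (Fin 3) ℝ) (hg : ∀ t ∈ Set.Ici t₀, (g t).PosDef)
    (f : ℝ → (Fin 3 → ℝ) → ℝ) (hfnn : ∀ t ∈ Set.Ici t₀, ∀ p, 0 ≤ f t p)
    (hfint : ∀ t ∈ Set.Ici t₀, Integrable (fun p : Fin 3 → ℝ => f t p))
    (hfint1 : ∀ t ∈ Set.Ici t₀,
      Integrable (fun p : Fin 3 → ℝ => f t p * Real.sqrt (1 + p ⬝ᵥ ((g t)⁻¹ *ᵥ p))))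
    (ε₁ : ℝ) (hε₁ : 0 < ε₁ ∧ ε₁ < 1 / 12)
    (C₀ : ℝ) (hC₀ : 0 < C₀)
    (hgauss : ∀ t ∈ Set.Ici t₀, ∀ ph : Fin 3 → ℝ,
      f t (chol (g t) *ᵥ ph) ≤ C₀ * Real.exp (-(t ^ ((4 : ℝ) / 3 - ε₁)) * (ph ⬝ᵥ ph)))
    (H : ℝ → ℝ) (hH : ∀ t ∈ Set.Ici t₀, 0 < H t ∧ H t ≤ 2 / 3 * t⁻¹)
    (hN0 : 0 < Ncur g f t₀)
    (hNder : ∀ t ∈ Set.Ici t₀,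
      HasDerivWithinAt (Ncur g f) (-3 * H t * Ncur g f t) (Set.Ici t₀) t) :
    ∃ ε ∈ Set.Ioo (0 : ℝ) 1, ∃ C > 0, ∃ c > 0, ∀ t ∈ Set.Ici t₀,
      c * t ^ (-(2 : ℝ)) ≤ rhoC g f t ∧
      rhoC g f t ≤ C * t ^ (-(2 : ℝ) + ε) ∧
      StrC g f t ≤ C * t ^ (-(10 : ℝ) / 3 + ε) ∧
      StrC g f t / rhoC g f t ≤ C * t ^ (-(4 : ℝ) / 3 + ε) := by
  obtain ⟨hε0, hε1⟩ := hε₁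
  set α : ℝ := 4 / 3 - ε₁ with hα
  have hα0 : 0 < α := by linarith
  set J : ℝ := ∫ x : Fin 3 → ℝ, Real.exp (-(x ⬝ᵥ x) / 2) with hJ
  have hJ0 : 0 ≤ J := integral_nonneg fun x => (Real.exp_pos _).le
  have hN (t : ℝ) (ht : t ∈ Set.Ici t₀) : 0 ≤ Ncur g f t :=
    mul_nonneg (by positivity) (integral_nonneg (hfnn t ht))
  set s₀ : ℝ := t₀ ^ α with hs₀
  have hs₀0 : 0 < s₀ := Real.rpow_pos_of_pos ht₀ _
  set c : ℝ := t₀ ^ 2 * Ncur g f t₀ with hc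
  have hc0 : 0 < c := by positivity
  have hlow (t : ℝ) (ht : t ∈ Set.Ici t₀) : c * t ^ (-(2 : ℝ)) ≤ rhoC g f t := by
    have ht0 : 0 < t := ht₀.trans_le ht
    refine le_trans ?_ (Ncur_le_rhoC (hg t ht) (hfnn t ht) (hfint t ht) (hfint1 t ht))
    have h := sq_mul_le_sq_mul_of_hasDerivWithinAt ht₀ hN (fun t ht => (hH t ht).2) hNder ht
    rw [Real.rpow_neg ht0.le, ← div_eq_mul_inv, div_le_iff₀ (by positivity)]
    norm_num
    linarith
  have hpt (t : ℝ) (ht : t ∈ Set.Ici t₀) (p : Fin 3 → ℝ) :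
      f t p ≤ C₀ * Real.exp (-(t ^ α * (p ⬝ᵥ ((g t)⁻¹ *ᵥ p)))) := by
    have h := hgauss t ht ((chol (g t))⁻¹ *ᵥ p)
    rwa [Matrix.mulVec_mulVec, Matrix.mul_nonsing_inv _ (isUnit_det_chol (hg t ht)),
      Matrix.one_mulVec, ← dotProduct_inv_mulVec_eq (hg t ht), neg_mul] at h
  have hrho (t : ℝ) (ht : t ∈ Set.Ici t₀) :
      rhoC g f t ≤ C₀ * (1 + s₀⁻¹) * 2 * J * t ^ (α * (-(3 : ℝ) / 2)) := by
    have ht0 : 0 < t := ht₀.trans_le ht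
    have hs : 0 < t ^ α := Real.rpow_pos_of_pos ht0 _
    rw [Real.rpow_mul ht0.le]
    refine momentum_integral_le (hg t ht) hs
      (fun p => mul_nonneg (hfnn t ht p) (Real.sqrt_nonneg _)) fun p => ?_
    have hq := dotProduct_inv_mulVec_nonneg (hg t ht) p
    have hp := hpt t ht p
    set q := p ⬝ᵥ ((g t)⁻¹ *ᵥ p)
    have hss : s₀ ≤ t ^ α := Real.rpow_le_rpow ht₀.le ht hα0.le
    have hu : 0 ≤ t ^ α * q := by positivity
    have h1 : Real.sqrt (1 + q) ≤ 1 + q := Real.sqrt_le_iff.2 ⟨by linarith, by nlinarith⟩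
    have h2 : 1 + q ≤ (1 + s₀⁻¹) * (1 + t ^ α * q) := by
      have : q ≤ s₀⁻¹ * (t ^ α * q) := by
        rw [inv_mul_eq_div, le_div_iff₀ hs₀0, mul_comm]; gcongr
      have : 0 < s₀⁻¹ := inv_pos.2 hs₀0
      nlinarith
    calc f t p * Real.sqrt (1 + q)
        ≤ C₀ * Real.exp (-(t ^ α * q)) * ((1 + s₀⁻¹) * (1 + t ^ α * q)) := by
          gcongr; exact h1.trans h2
      _ = C₀ * (1 + s₀⁻¹) * ((1 + t ^ α * q) * Real.exp (-(t ^ α * q))) := by ring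
      _ ≤ C₀ * (1 + s₀⁻¹) * (2 * Real.exp (-(t ^ α * q) / 2)) := by
          gcongr C₀ * (1 + s₀⁻¹) * ?_; exact one_add_mul_exp_neg_le _
      _ = _ := by ring
  have hS (t : ℝ) (ht : t ∈ Set.Ici t₀) :
      StrC g f t ≤ C₀ * 2 * J * t ^ (α * (-(5 : ℝ) / 2)) := by
    have ht0 : 0 < t := ht₀.trans_le ht
    have hs : 0 < t ^ α := Real.rpow_pos_of_pos ht0 _
    have he : C₀ * 2 * J * t ^ (α * (-(5 : ℝ) / 2)) =
        C₀ * 2 * (t ^ α)⁻¹ * J * (t ^ α) ^ (-(3 : ℝ) / 2) := by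
      have : α * (-(5 : ℝ) / 2) = -α + α * (-(3 : ℝ) / 2) := by ring
      rw [this, Real.rpow_add ht0, Real.rpow_neg ht0.le, Real.rpow_mul ht0.le]
      ring
    rw [he, StrC_eq (hg t ht) (hfint t ht) (hfint1 t ht)]
    refine momentum_integral_le (hg t ht) hs (fun p => ?_) fun p => ?_
    · exact div_nonneg (mul_nonneg (hfnn t ht p) (dotProduct_inv_mulVec_nonneg (hg t ht) p))
        (Real.sqrt_nonneg _)
    have hq := dotProduct_inv_mulVec_nonneg (hg t ht) p
    have hp := hpt t ht p
    have hf0 := hfnn t ht p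
    set q := p ⬝ᵥ ((g t)⁻¹ *ᵥ p)
    have hu : 0 ≤ t ^ α * q := by positivity
    calc f t p * q / Real.sqrt (1 + q) ≤ f t p * q :=
          div_le_self (mul_nonneg hf0 hq) (Real.one_le_sqrt.2 (by linarith))
      _ ≤ C₀ * Real.exp (-(t ^ α * q)) * q := by gcongr
      _ = C₀ * (t ^ α)⁻¹ * (t ^ α * q * Real.exp (-(t ^ α * q))) := by field_simp
      _ ≤ C₀ * (t ^ α)⁻¹ * (2 * Real.exp (-(t ^ α * q) / 2)) := by
          gcongr C₀ * (t ^ α)⁻¹ * ?_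
          refine le_trans ?_ (one_add_mul_exp_neg_le _)
          gcongr
          linarith
      _ = _ := by ring
  set A : ℝ := C₀ * (1 + s₀⁻¹) * 2 * J with hA
  set B : ℝ := C₀ * 2 * J with hB
  have hA0 : 0 ≤ A := by positivity
  have hB0 : 0 ≤ B := by positivity
  have hD0 : 0 < t₀ ^ ε₁ := Real.rpow_pos_of_pos ht₀ _
  have hP : 0 ≤ A * (t₀ ^ ε₁)⁻¹ := by positivity
  have hQ : 0 ≤ B / c := by positivity
  refine ⟨5 / 2 * ε₁, ⟨by linarith, by linarith⟩, 1 + A * (t₀ ^ ε₁)⁻¹ + B + B / c,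
    by linarith, c, hc0, fun t ht => ?_⟩
  have ht0 : 0 < t := ht₀.trans_le ht
  have hSt : StrC g f t ≤ B * t ^ (-(10 : ℝ) / 3 + 5 / 2 * ε₁) := by
    refine (hS t ht).trans_eq ?_
    congr 2; rw [hα]; ring
  refine ⟨hlow t ht, ?_, ?_, ?_⟩
  · have he : t ^ (-(2 : ℝ) + 5 / 2 * ε₁) = t ^ ε₁ * t ^ (α * (-(3 : ℝ) / 2)) := by
      rw [← Real.rpow_add ht0]; congr 1; rw [hα]; ring
    have h1 : 1 ≤ (t₀ ^ ε₁)⁻¹ * t ^ ε₁ := by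
      rw [inv_mul_eq_div, one_le_div hD0]
      exact Real.rpow_le_rpow ht₀.le ht hε0.le
    calc rhoC g f t ≤ A * t ^ (α * (-(3 : ℝ) / 2)) := hrho t ht
      _ ≤ A * t ^ (α * (-(3 : ℝ) / 2)) * ((t₀ ^ ε₁)⁻¹ * t ^ ε₁) :=
          le_mul_of_one_le_right (by positivity) h1
      _ = A * (t₀ ^ ε₁)⁻¹ * t ^ (-(2 : ℝ) + 5 / 2 * ε₁) := by rw [he]; ring
      _ ≤ _ := by gcongr; linarith
  · refine hSt.trans ?_
    gcongr; linarith
  · have hpos : 0 < c * t ^ (-(2 : ℝ)) := by positivity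
    calc StrC g f t / rhoC g f t
        ≤ B * t ^ (-(10 : ℝ) / 3 + 5 / 2 * ε₁) / rhoC g f t := by
          have := hpos.trans_le (hlow t ht)
          gcongr
      _ ≤ B * t ^ (-(10 : ℝ) / 3 + 5 / 2 * ε₁) / (c * t ^ (-(2 : ℝ))) := by
          gcongr; exact hlow t ht
      _ = B / c * t ^ (-(4 : ℝ) / 3 + 5 / 2 * ε₁) := by
          have : -(10 : ℝ) / 3 + 5 / 2 * ε₁ = -(4 : ℝ) / 3 + 5 / 2 * ε₁ + -2 := by ring
          rw [this, Real.rpow_add ht0]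
          field_simp
      _ ≤ _ := by gcongr; linarith
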